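/- Any submodular welfare rule w with w(0)=0, w(1)=1, and curvature at most c can be written as a non-negative combination of b-covering welfare rules: w = Σ_{b≥1} α^b w_b where α^b = (2w(b) − w(b−1) − w(b+1))/c ≥ 0 for all b, provided c > 0 and 1 − lim_j (w(j+1)−w(j)) = c. -/

import Mathlib

open Filter

theorem Antitone.hasSum_sub_succ {e : ℕ → ℝ} {l : ℝ} (he : Antitone e)
    (hl : Tendsto e atTop (nhds l)) : HasSum (fun n => e n - e (n + 1)) (e 0 - l) := by
  rw [hasSum_iff_tendsto_nat_of_nonneg fun n => sub_nonneg.2 (he n.le_succ)]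
  simpa only [Finset.sum_range_sub'] using hl.const_sub (e 0)

/-- Any submodular welfare rule with curvature exactly `c ∈ (0,1]` is a non-negative
combination of `b`-covering welfare rules, with coefficients
`α b = (2 w(b) - w(b-1) - w(b+1))/c`. -/
theorem submodular_decomposition_into_bCovering (w : ℕ → ℝ) (c : ℝ)
    (hc0 : 0 < c) (hc1 : c ≤ 1)
    (h0 : w 0 = 0) (h1 : w 1 = 1)
    (hmono : ∀ j, w j ≤ w (j + 1))
    (hsub : ∀ j k, j ≤ k → w (k + 1) - w k ≤ w (j + 1) - w j)
    (hcurv : Tendsto (fun j : ℕ => w (j + 1) - w j) atTop (nhds (1 - c)))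
    (wcov : ℕ → ℕ → ℝ)
    (hwcov : ∀ b j : ℕ, wcov b j =
      if j ≤ b then (j : ℝ) else (b : ℝ) + (1 - c) * ((j : ℝ) - (b : ℝ)))
    (α : ℕ → ℝ)
    (hα : ∀ b : ℕ, α b = (2 * w b - w (b - 1) - w (b + 1)) / c) :
    (∀ b : ℕ, 1 ≤ b → 0 ≤ α b) ∧
    (∀ j : ℕ, HasSum (fun b : ℕ => α (b + 1) * wcov (b + 1) j) (w j)) := by
  have hα' (b : ℕ) : α (b + 1) = ((w (b + 1) - w b) - (w (b + 2) - w (b + 1))) / c := by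
    rw [hα, Nat.add_sub_cancel]
    ring
  refine ⟨fun b hb => ?_, fun j => ?_⟩
  · obtain ⟨b, rfl⟩ := Nat.exists_eq_add_of_le' hb
    rw [hα']
    exact div_nonneg (sub_nonneg.2 (hsub b (b + 1) b.le_succ)) hc0.le
  set d : ℕ → ℝ := fun n => w (n + 1) - w n with hd
  have hd_anti : Antitone d := fun m n h => hsub m n h
  induction j with
  | zero => simp [hwcov, h0, hasSum_zero]
  | succ j ih =>
    set e : ℕ → ℝ := fun n => ((1 - c) * d n + c * d (max j n)) / c with he
    have he_anti : Antitone e := fun m n h => by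
      have hm : d (max j n) ≤ d (max j m) := hd_anti (max_le_max_left j h)
      have hn : d n ≤ d m := hd_anti h
      have : 0 ≤ 1 - c := by linarith
      simp only [he]
      gcongr
    have he_lim : Tendsto e atTop (nhds (((1 - c) * (1 - c) + c * (1 - c)) / c)) :=
      ((hcurv.const_mul _).add ((hcurv.comp (tendsto_atTop_mono (le_max_right j)
        tendsto_id)).const_mul _)).div_const c
    convert ih.add (he_anti.hasSum_sub_succ he_lim) using 1
    · funext b
      rw [hα', hwcov, hwcov]
      rcases le_or_gt j b with h | h
      · rw [if_pos (by lia), if_pos (by lia)]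
        simp only [he, hd, max_eq_right h, max_eq_right (h.trans b.le_succ)]
        push_cast
        field_simp
        ring
      · have hcov : (if j ≤ b + 1 then (j : ℝ)
            else ((b + 1 : ℕ) : ℝ) + (1 - c) * ((j : ℝ) - ((b + 1 : ℕ) : ℝ))) =
            ((b + 1 : ℕ) : ℝ) + (1 - c) * ((j : ℝ) - ((b + 1 : ℕ) : ℝ)) := by
          split_ifs with hj
          · obtain rfl : j = b + 1 := by lia
            simp
          · rfl
        rw [if_neg (by lia), hcov]
        simp only [he, hd, max_eq_left h.le, max_eq_left (Nat.succ_le_of_lt h)]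
        push_cast
        field_simp
        ring
    · simp only [he, hd, Nat.max_zero, zero_add, h0, h1]
      field_simp
      ring
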